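/- Let m ≥ 1 and T ≥ 1 be integers, let L > 0, σ > 0, ζ ≥ 0, M₁ ≥ 0, M₂ ≥ 0, δ ∈ (0,1) be reals, and let p : ℕ → ℝ be a sequence with δ ≤ p(t) ≤ 1 for all t. Let f, e, Ξ : ℕ → ℝ be sequences with f(t) ≥ 0, e(t) ≥ 0, Ξ(t) ≥ 0 for all t, and with f₀ := f(0) > 0. Define κ := √((1+M₁)(1+M₂))/δ, α(T) := 2L²·( (σ² + M₁ζ²)·Π₁(T) + 6ζ²·Π₂(T) ), and η := min{ √(m·f₀/(σ²·L·T)), (f₀/(T·α(T)))^{1/3}, 1/(20·L·κ), 1/(4·L·(M₁+1)) }. Assume that for every t ≥ 0, f(t+1) ≤ f(t) − (η/4)·e(t) + L·σ²·η²/m + η·L²·Ξ(t), and that for every t ≥ 1, Ξ(t) ≤ (1 − p(t−1)/2)·Ξ(t−1) + 2η²·( (6/p(t−1) + M₁)·(M₂·e(t−1) + ζ²) + σ² ). Then (1/(16T))·∑_{t=0}^{T−1} e(t) ≤ 2·√(σ²·L·f₀/(m·T)) + 2·( f₀²·α(T)/T² )^{1/3} + L²·(2 + π₀)·Ξ(0)/T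 + 20·L·κ·f₀/T + 4·f₀·L·(M₁+1)/T. -/

import Mathlib

/-- `piSeq p j = ∑_{i > j} ∏_{t=j+1}^{i-1} (1 - p t / 2)`. -/
noncomputable def piSeq (p : ℕ → ℝ) (j : ℕ) : ℝ :=
  ∑' k : ℕ, ∏ t ∈ Finset.Ico (j + 1) (j + 1 + k), (1 - p t / 2)

/-- `Π₁(T) = (1/T) ∑_{j=0}^{T-1} π_j`. -/
noncomputable def Pi1 (p : ℕ → ℝ) (T : ℕ) : ℝ :=
  (1 / (T : ℝ)) * ∑ j ∈ Finset.range T, piSeq p j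

/-- `Π₂(T) = (1/T) ∑_{j=0}^{T-1} π_j / p j`. -/
noncomputable def Pi2 (p : ℕ → ℝ) (T : ℕ) : ℝ :=
  (1 / (T : ℝ)) * ∑ j ∈ Finset.range T, piSeq p j / p j

lemma prod_Ico_nonneg_and_le_pow {p : ℕ → ℝ} {δ : ℝ} (hp : ∀ t, δ ≤ p t ∧ p t ≤ 1) (a k : ℕ) :
    0 ≤ ∏ t ∈ Finset.Ico a (a + k), (1 - p t / 2) ∧
      ∏ t ∈ Finset.Ico a (a + k), (1 - p t / 2) ≤ (1 - δ / 2) ^ k := by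
  refine ⟨Finset.prod_nonneg fun t _ => by linarith [(hp t).2], ?_⟩
  calc ∏ t ∈ Finset.Ico a (a + k), (1 - p t / 2)
      ≤ ∏ _t ∈ Finset.Ico a (a + k), (1 - δ / 2) :=
        Finset.prod_le_prod (fun t _ => by linarith [(hp t).2])
          (fun t _ => by linarith [(hp t).1])
    _ = (1 - δ / 2) ^ k := by simp

lemma hasSum_pow_one_sub_half {δ : ℝ} (h0 : 0 < δ) (h1 : δ < 1) :
    HasSum (fun k : ℕ => (1 - δ / 2) ^ k) (2 / δ) := by
  have h := hasSum_geometric_of_lt_one (r := 1 - δ / 2) (by linarith) (by linarith)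
  have e : (1 - (1 - δ / 2))⁻¹ = 2 / δ := by
    rw [sub_sub_cancel, inv_div]
  rwa [e] at h

lemma summable_prod_Ico {p : ℕ → ℝ} {δ : ℝ} (h0 : 0 < δ) (h1 : δ < 1)
    (hp : ∀ t, δ ≤ p t ∧ p t ≤ 1) (a : ℕ) :
    Summable fun k : ℕ => ∏ t ∈ Finset.Ico a (a + k), (1 - p t / 2) :=
  .of_nonneg_of_le (fun k => (prod_Ico_nonneg_and_le_pow hp a k).1)
    (fun k => (prod_Ico_nonneg_and_le_pow hp a k).2) (hasSum_pow_one_sub_half h0 h1).summable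

lemma piSeq_le {p : ℕ → ℝ} {δ : ℝ} (h0 : 0 < δ) (h1 : δ < 1)
    (hp : ∀ t, δ ≤ p t ∧ p t ≤ 1) (j : ℕ) : piSeq p j ≤ 2 / δ :=
  hasSum_le (fun k => (prod_Ico_nonneg_and_le_pow hp _ k).2)
    (summable_prod_Ico h0 h1 hp _).hasSum (hasSum_pow_one_sub_half h0 h1)

lemma piSeq_nonneg {p : ℕ → ℝ} {δ : ℝ} (hp : ∀ t, δ ≤ p t ∧ p t ≤ 1) (j : ℕ) :
    0 ≤ piSeq p j :=
  tsum_nonneg fun k => (prod_Ico_nonneg_and_le_pow hp _ k).1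

lemma piSeq_eq_one_add {p : ℕ → ℝ} {δ : ℝ} (h0 : 0 < δ) (h1 : δ < 1)
    (hp : ∀ t, δ ≤ p t ∧ p t ≤ 1) (j : ℕ) :
    piSeq p j = 1 + (1 - p (j + 1) / 2) * piSeq p (j + 1) := by
  unfold piSeq
  rw [(summable_prod_Ico h0 h1 hp (j + 1)).tsum_eq_zero_add, ← tsum_mul_left]
  congr 1
  · simp
  · refine tsum_congr fun k => ?_
    rw [Finset.prod_eq_prod_Ico_succ_bot (by omega)]
    congr 3
    omega

lemma one_le_piSeq {p : ℕ → ℝ} {δ : ℝ} (h0 : 0 < δ) (h1 : δ < 1)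
    (hp : ∀ t, δ ≤ p t ∧ p t ≤ 1) (j : ℕ) : 1 ≤ piSeq p j := by
  rw [piSeq_eq_one_add h0 h1 hp j]
  have := mul_nonneg (show 0 ≤ 1 - p (j + 1) / 2 by linarith [(hp (j + 1)).2])
    (piSeq_nonneg hp (j + 1))
  linarith

/-- Unrolling a perturbed contraction with time-varying factors `1 - p t / 2`. -/
lemma sum_le_of_contraction {p Ξ c : ℕ → ℝ} {δ : ℝ} (h0 : 0 < δ) (h1 : δ < 1)
    (hp : ∀ t, δ ≤ p t ∧ p t ≤ 1) (hΞ : ∀ t, 0 ≤ Ξ t) (hc : ∀ t, 0 ≤ c t)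
    (h : ∀ t, Ξ (t + 1) ≤ (1 - p t / 2) * Ξ t + c t) (T : ℕ) :
    ∑ t ∈ Finset.range T, Ξ t ≤
      (1 + piSeq p 0) * Ξ 0 + ∑ j ∈ Finset.range T, piSeq p j * c j := by
  have key : ∀ n, ∑ t ∈ Finset.range (n + 1), Ξ t + (1 - p n / 2) * piSeq p n * Ξ n ≤
      (1 + piSeq p 0) * Ξ 0 + ∑ j ∈ Finset.range n, piSeq p j * c j := by
    intro n
    induction n with
    | zero =>
      have := mul_nonneg (mul_nonneg (h0.le.trans (hp 0).1) (piSeq_nonneg hp 0)) (hΞ 0)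
      simp only [zero_add, Finset.sum_range_one, Finset.sum_range_zero]
      linarith
    | succ n ih =>
      rw [Finset.sum_range_succ, Finset.sum_range_succ (fun j => piSeq p j * c j)]
      have h2 := mul_le_mul_of_nonneg_left (h n) (piSeq_nonneg hp n)
      have h3 : piSeq p n * Ξ (n + 1) =
          (1 + (1 - p (n + 1) / 2) * piSeq p (n + 1)) * Ξ (n + 1) := by
        rw [← piSeq_eq_one_add h0 h1 hp n]
      linarith
  have hpc : 0 ≤ piSeq p T * c T := mul_nonneg (piSeq_nonneg hp T) (hc T)
  have hV : 0 ≤ (1 - p T / 2) * piSeq p T * Ξ T :=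
    mul_nonneg (mul_nonneg (by linarith [(hp T).2]) (piSeq_nonneg hp T)) (hΞ T)
  have := key T
  rw [Finset.sum_range_succ] at this
  linarith [hΞ T]

lemma one_div_min_le {a b : ℝ} (ha : 0 < a) (hb : 0 < b) :
    1 / min a b ≤ 1 / a + 1 / b := by
  have := one_div_pos.2 ha
  have := one_div_pos.2 hb
  rcases min_choice a b with h | h <;> rw [h] <;> linarith

/-- The square-root step size balances `A / η` against `B * η`. -/
lemma sqrt_step_balance {A B : ℝ} (hA : 0 < A) (hB : 0 < B) :
    A * (1 / √(A / B)) = √(A * B) ∧ B * √(A / B) = √(A * B) := by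
  have hAB : 0 < A / B := div_pos hA hB
  have e : √(A * B) = B * √(A / B) := by
    rw [show A * B = B ^ 2 * (A / B) by field_simp, Real.sqrt_mul (by positivity),
      Real.sqrt_sq hB.le]
  refine ⟨?_, e.symm⟩
  have hs := Real.mul_self_sqrt hAB.le
  have hpos := Real.sqrt_pos.2 hAB
  rw [e]
  field_simp
  rw [pow_two, hs]
  field_simp

/-- The cube-root step size balances `A / η` against `B * η ^ 2`. -/
lemma cbrt_step_balance {A B : ℝ} (hA : 0 < A) (hB : 0 < B) :
    A * (1 / (A / B) ^ ((1 : ℝ) / 3)) = (A ^ 2 * B) ^ ((1 : ℝ) / 3) ∧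
      B * ((A / B) ^ ((1 : ℝ) / 3)) ^ 2 = (A ^ 2 * B) ^ ((1 : ℝ) / 3) := by
  have hAB : 0 < A / B := div_pos hA hB
  set x := (A / B) ^ ((1 : ℝ) / 3) with hx
  have hxpos : 0 < x := Real.rpow_pos_of_pos hAB _
  have hx3 : x ^ 3 = A / B := by
    rw [hx, ← Real.rpow_natCast, ← Real.rpow_mul hAB.le]; norm_num
  have hA' : A = B * x ^ 3 := by rw [hx3]; field_simp
  have e : (A ^ 2 * B) ^ ((1 : ℝ) / 3) = B * x ^ 2 := by
    rw [show A ^ 2 * B = (B * x ^ 2) ^ 3 by rw [hA']; ring, ← Real.rpow_natCast,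
      ← Real.rpow_mul (by positivity)]
    norm_num
  refine ⟨?_, e.symm⟩
  rw [e]
  conv_lhs => rw [hA']
  field_simp

lemma average_le_of_descent {f e Ξ : ℕ → ℝ} {η b L : ℝ} {T : ℕ} (hη : 0 < η) (hT : 1 ≤ T)
    (hf : ∀ t, 0 ≤ f t)
    (h : ∀ t, f (t + 1) ≤ f t - η / 4 * e t + b * η ^ 2 + η * L ^ 2 * Ξ t) :
    1 / (4 * (T : ℝ)) * ∑ t ∈ Finset.range T, e t ≤
      f 0 / T * (1 / η) + b * η + L ^ 2 / T * ∑ t ∈ Finset.range T, Ξ t := by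
  have key : ∀ n : ℕ, f n + η / 4 * ∑ t ∈ Finset.range n, e t ≤
      f 0 + n * (b * η ^ 2) + η * L ^ 2 * ∑ t ∈ Finset.range n, Ξ t := by
    intro n
    induction n with
    | zero => simp
    | succ n ih =>
      rw [Finset.sum_range_succ, Finset.sum_range_succ]
      push_cast
      linarith [h n]
  have hT' : (0 : ℝ) < T := by exact_mod_cast hT
  have h2 : η / 4 * ∑ t ∈ Finset.range T, e t ≤
      f 0 + T * (b * η ^ 2) + η * L ^ 2 * ∑ t ∈ Finset.range T, Ξ t := by
    linarith [key T, hf T]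
  have h3 := mul_le_mul_of_nonneg_left h2 (show 0 ≤ 1 / (η * T) by positivity)
  calc _ = 1 / (η * T) * (η / 4 * ∑ t ∈ Finset.range T, e t) := by field_simp
    _ ≤ _ := h3
    _ = _ := by field_simp

/-- The step-size condition makes the gradient terms in the consensus recursion absorbable. -/
lemma gradient_coeff_le {δ q x M₁ M₂ L η : ℝ} (h0 : 0 < δ) (h1 : δ ≤ 1) (hM₁ : 0 ≤ M₁)
    (hM₂ : 0 ≤ M₂) (hq : δ ≤ q) (hxδ : x ≤ 2 / δ)
    (hη : 400 * L ^ 2 * ((1 + M₁) * (1 + M₂)) * η ^ 2 ≤ δ ^ 2) :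
    L ^ 2 * (2 * η ^ 2 * (x * ((6 / q + M₁) * M₂))) ≤ 6 / 100 := by
  have hq0 : 0 < q := h0.trans_le hq
  have h2 : 6 / q + M₁ ≤ 6 * (1 + M₁) / δ := by
    have : 6 / q ≤ 6 / δ := div_le_div_of_nonneg_left (by norm_num) h0 hq
    have h3 : M₁ ≤ 6 * M₁ / δ := by rw [le_div_iff₀ h0]; nlinarith
    rw [mul_add, add_div, mul_one]
    linarith
  have h3 : (6 / q + M₁) * M₂ ≤ 6 * (1 + M₁) / δ * (1 + M₂) :=
    mul_le_mul h2 (by linarith) hM₂ (by positivity)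
  have h4 : x * ((6 / q + M₁) * M₂) ≤ 2 / δ * (6 * (1 + M₁) / δ * (1 + M₂)) :=
    mul_le_mul hxδ h3 (by positivity) (by positivity)
  calc _ ≤ L ^ 2 * (2 * η ^ 2 * (2 / δ * (6 * (1 + M₁) / δ * (1 + M₂)))) :=
        mul_le_mul_of_nonneg_left (mul_le_mul_of_nonneg_left h4 (by positivity)) (sq_nonneg L)
    _ = 6 / 100 * (400 * L ^ 2 * ((1 + M₁) * (1 + M₂)) * η ^ 2) / δ ^ 2 := by
      field_simp
      ring
    _ ≤ 6 / 100 := by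
      rw [div_le_iff₀ (by positivity)]
      exact mul_le_mul_of_nonneg_left hη (by norm_num)

theorem stmt13 (m T : ℕ) (hm : 1 ≤ m) (hT : 1 ≤ T)
    (L σ ζ M₁ M₂ δ : ℝ) (hL : 0 < L) (hσ : 0 < σ) (hζ : 0 ≤ ζ)
    (hM₁ : 0 ≤ M₁) (hM₂ : 0 ≤ M₂) (hδ0 : 0 < δ) (hδ1 : δ < 1)
    (p : ℕ → ℝ) (hp : ∀ t : ℕ, δ ≤ p t ∧ p t ≤ 1)
    (f e Ξ : ℕ → ℝ) (hf : ∀ t, 0 ≤ f t) (he : ∀ t, 0 ≤ e t) (hΞ : ∀ t, 0 ≤ Ξ t)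
    (hf₀ : 0 < f 0)
    (κ : ℝ) (hκ : κ = Real.sqrt ((1 + M₁) * (1 + M₂)) / δ)
    (α : ℝ) (hα : α = 2 * L ^ 2 * ((σ ^ 2 + M₁ * ζ ^ 2) * Pi1 p T + 6 * ζ ^ 2 * Pi2 p T))
    (η : ℝ)
    (hη : η = min (Real.sqrt ((m : ℝ) * f 0 / (σ ^ 2 * L * T)))
      (min ((f 0 / ((T : ℝ) * α)) ^ ((1 : ℝ) / 3))
        (min (1 / (20 * L * κ)) (1 / (4 * L * (M₁ + 1))))))
    (hdescent : ∀ t : ℕ,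
      f (t + 1) ≤ f t - η / 4 * e t + L * σ ^ 2 * η ^ 2 / m + η * L ^ 2 * Ξ t)
    (hconsensus : ∀ t : ℕ, 1 ≤ t →
      Ξ t ≤ (1 - p (t - 1) / 2) * Ξ (t - 1) +
        2 * η ^ 2 * ((6 / p (t - 1) + M₁) * (M₂ * e (t - 1) + ζ ^ 2) + σ ^ 2)) :
    1 / (16 * (T : ℝ)) * ∑ t ∈ Finset.range T, e t ≤
      2 * Real.sqrt (σ ^ 2 * L * f 0 / (m * T)) +
        2 * (f 0 ^ 2 * α / (T : ℝ) ^ 2) ^ ((1 : ℝ) / 3) +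
        L ^ 2 * (2 + piSeq p 0) * Ξ 0 / T +
        20 * L * κ * f 0 / T +
        4 * f 0 * L * (M₁ + 1) / T := by
  have hTpos : (0 : ℝ) < T := by exact_mod_cast hT
  have hmpos : (0 : ℝ) < m := by exact_mod_cast hm
  have hp0 : ∀ t, 0 < p t := fun t => hδ0.trans_le (hp t).1
  have hπ0 := piSeq_nonneg hp
  have hPi1 : 0 < Pi1 p T := by
    refine mul_pos (by positivity) (Finset.sum_pos (fun j _ => ?_) ⟨0, by simp; omega⟩)
    linarith [one_le_piSeq hδ0 hδ1 hp j]
  have hPi2 : 0 ≤ Pi2 p T :=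
    mul_nonneg (by positivity) (Finset.sum_nonneg fun j _ => div_nonneg (hπ0 j) (hp0 j).le)
  have hαpos : 0 < α := by rw [hα]; positivity
  have hκpos : 0 < κ := by rw [hκ]; positivity
  have hκsq : κ ^ 2 * δ ^ 2 = (1 + M₁) * (1 + M₂) := by
    rw [hκ, div_pow, Real.sq_sqrt (by positivity)]
    field_simp
  set s := Real.sqrt ((m : ℝ) * f 0 / (σ ^ 2 * L * T)) with hs
  set r := (f 0 / ((T : ℝ) * α)) ^ ((1 : ℝ) / 3) with hr
  have hspos : 0 < s := Real.sqrt_pos.2 (by positivity)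
  have hrpos : 0 < r := Real.rpow_pos_of_pos (by positivity) _
  have hk : 0 < 1 / (20 * L * κ) := by positivity
  have hM : 0 < 1 / (4 * L * (M₁ + 1)) := by positivity
  have hηpos : 0 < η := by rw [hη]; exact lt_min hspos (lt_min hrpos (lt_min hk hM))
  have hηs : η ≤ s := hη ▸ min_le_left _ _
  have hηr : η ≤ r := hη ▸ (min_le_right _ _).trans (min_le_left _ _)
  have hηk : η ≤ 1 / (20 * L * κ) :=
    hη ▸ (min_le_right _ _).trans ((min_le_right _ _).trans (min_le_left _ _))
  have hηinv : 1 / η ≤ 1 / s + (1 / r + (20 * L * κ + 4 * L * (M₁ + 1))) := by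
    have h1 := one_div_min_le hspos (lt_min hrpos (lt_min hk hM))
    have h2 := one_div_min_le hrpos (lt_min hk hM)
    have h3 := one_div_min_le hk hM
    rw [one_div_one_div, one_div_one_div] at h3
    rw [hη]
    linarith
  obtain ⟨hs1, hs2⟩ := sqrt_step_balance (A := f 0 / T) (B := L * σ ^ 2 / m)
    (by positivity) (by positivity)
  obtain ⟨hr1, hr2⟩ := cbrt_step_balance (A := f 0 / T) (B := α) (by positivity) hαpos
  rw [show f 0 / T / (L * σ ^ 2 / m) = (m : ℝ) * f 0 / (σ ^ 2 * L * T) by field_simp,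
    ← hs, show f 0 / T * (L * σ ^ 2 / m) = σ ^ 2 * L * f 0 / (m * T) by field_simp] at hs1 hs2
  rw [show f 0 / T / α = f 0 / ((T : ℝ) * α) by field_simp, ← hr,
    show (f 0 / T) ^ 2 * α = f 0 ^ 2 * α / (T : ℝ) ^ 2 by field_simp] at hr1 hr2
  have hdesc := average_le_of_descent (b := L * σ ^ 2 / m) (L := L) hηpos hT hf
    (e := e) (Ξ := Ξ) (fun t => (hdescent t).trans_eq (by ring))
  have hcons := sum_le_of_contraction hδ0 hδ1 hp hΞ
    (c := fun t => 2 * η ^ 2 * ((6 / p t + M₁) * (M₂ * e t + ζ ^ 2) + σ ^ 2))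
    (fun t => by have := hp0 t; have := he t; positivity)
    (fun t => by simpa using hconsensus (t + 1) (by omega)) T
  have hη2 : 400 * L ^ 2 * ((1 + M₁) * (1 + M₂)) * η ^ 2 ≤ δ ^ 2 := by
    have h1 : η * (20 * L * κ) ≤ 1 := by rwa [le_div_iff₀ (by positivity)] at hηk
    have h2 : (η * (20 * L * κ)) ^ 2 ≤ 1 := pow_le_one₀ (by positivity) h1
    rw [← hκsq]
    nlinarith [mul_le_mul_of_nonneg_left h2 (sq_nonneg δ)]
  have hcoef : ∀ t, L ^ 2 * (2 * η ^ 2 * (piSeq p t * ((6 / p t + M₁) * M₂))) ≤ 6 / 100 :=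
    fun t => gradient_coeff_le hδ0 hδ1.le hM₁ hM₂ (hp t).1 (piSeq_le hδ0 hδ1 hp t) hη2
  have hsum : L ^ 2 / T * ∑ j ∈ Finset.range T, piSeq p j *
        (2 * η ^ 2 * ((6 / p j + M₁) * (M₂ * e j + ζ ^ 2) + σ ^ 2)) ≤
      α * η ^ 2 + 6 / 100 * (1 / T * ∑ t ∈ Finset.range T, e t) := by
    have h1 : α * η ^ 2 = 1 / T * ∑ j ∈ Finset.range T, 2 * L ^ 2 * η ^ 2 *
        ((σ ^ 2 + M₁ * ζ ^ 2) * piSeq p j + 6 * ζ ^ 2 * (piSeq p j / p j)) := by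
      rw [hα, Pi1, Pi2, ← Finset.mul_sum, Finset.sum_add_distrib, ← Finset.mul_sum,
        ← Finset.mul_sum]
      ring
    rw [h1, show ∀ x : ℝ, 6 / 100 * (1 / T * x) = 1 / T * (6 / 100 * x) by intro x; ring,
      ← mul_add, Finset.mul_sum _ _ (6 / 100 : ℝ), ← Finset.sum_add_distrib,
      div_eq_mul_one_div, mul_comm (L ^ 2), mul_assoc, Finset.mul_sum]
    refine mul_le_mul_of_nonneg_left (Finset.sum_le_sum fun j _ => ?_) (by positivity)
    have := mul_le_mul_of_nonneg_right (hcoef j) (he j)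
    calc _ = 2 * L ^ 2 * η ^ 2 *
          ((σ ^ 2 + M₁ * ζ ^ 2) * piSeq p j + 6 * ζ ^ 2 * (piSeq p j / p j)) +
          L ^ 2 * (2 * η ^ 2 * (piSeq p j * ((6 / p j + M₁) * M₂))) * e j := by ring
      _ ≤ _ := by linarith
  have h1 := mul_le_mul_of_nonneg_left hηinv (show 0 ≤ f 0 / T by positivity)
  have h2 : L * σ ^ 2 / m * η ≤ L * σ ^ 2 / m * s := by gcongr
  have h3 : α * η ^ 2 ≤ α * r ^ 2 := by gcongr
  have h4 := mul_le_mul_of_nonneg_left hcons (show 0 ≤ L ^ 2 / T by positivity)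
  have hE : 0 ≤ 1 / (T : ℝ) * ∑ t ∈ Finset.range T, e t :=
    mul_nonneg (by positivity) (Finset.sum_nonneg fun t _ => he t)
  have hΞ0 : L ^ 2 / T * ((1 + piSeq p 0) * Ξ 0) ≤ L ^ 2 * (2 + piSeq p 0) * Ξ 0 / T := by
    have : 0 ≤ L ^ 2 / T * Ξ 0 := mul_nonneg (by positivity) (hΞ 0)
    calc _ ≤ L ^ 2 / T * ((1 + piSeq p 0) * Ξ 0) + L ^ 2 / T * Ξ 0 := by linarith
      _ = _ := by ring
  have hE4 : 1 / (4 * (T : ℝ)) * ∑ t ∈ Finset.range T, e t =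
      1 / 4 * (1 / T * ∑ t ∈ Finset.range T, e t) := by ring
  have hE16 : 1 / (16 * (T : ℝ)) * ∑ t ∈ Finset.range T, e t =
      1 / 16 * (1 / T * ∑ t ∈ Finset.range T, e t) := by ring
  rw [hE4] at hdesc
  rw [mul_add] at h4
  rw [mul_add, mul_add, hs1, hr1,
    show f 0 / T * (20 * L * κ + 4 * L * (M₁ + 1)) =
      20 * L * κ * f 0 / T + 4 * f 0 * L * (M₁ + 1) / T by ring] at h1
  rw [hE16]
  linarith
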